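/- For all nonempty homogeneous Σ¹₁ sets A = ∏ₙAₙ and B = ∏ₙBₙ with every Aₙ and every Bₙ finite, there exists a uniformly Σ¹₁ family (Xₙ) of subsets of ℕ, each Xₙ being either all of ℕ or nonempty and finite, such that ∏ₙXₙ ≤_M A, ∏ₙXₙ ≤_M B, and every nonempty homogeneous Σ¹₁ set Y with Y ≤_M A and Y ≤_M B satisfies Y ≤_M ∏ₙXₙ. -/

import Mathlib

open Set

/-- Baire space. -/
abbrev Baire : Type := ℕ → ℕ

/-- The length-`n` initial segment of `x : Baire`, as a finite sequence. -/
def pre (x : Baire) (n : ℕ) : List ℕ := (List.range n).map x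

/-- A Turing functional, presented by a total computable monotone map on
finite sequences. -/
structure TuringFunctional where
  φ : List ℕ → List ℕ
  computable : Computable φ
  mono : ∀ σ τ : List ℕ, σ <+: τ → φ σ <+: φ τ

/-- `Φ` is defined on `x` with value `y`: every coordinate of `y` is eventually
output by `Φ` on initial segments of `x`. -/
def TuringFunctional.Eval (Φ : TuringFunctional) (x y : Baire) : Prop :=
  ∀ n, ∃ m, (Φ.φ (pre x m))[n]? = some (y n)

/-- Medvedev reducibility: some Turing functional is defined on every element
of `Q` and maps `Q` into `P`. -/
def MedvedevLE (P Q : Set Baire) : Prop :=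
  ∃ Φ : TuringFunctional, ∀ x ∈ Q, ∃ y ∈ P, Φ.Eval x y

/-- Strict Medvedev reducibility. -/
def MedvedevLT (P Q : Set Baire) : Prop := MedvedevLE P Q ∧ ¬ MedvedevLE Q P

/-- The homogeneous set `∏ₙ Aₙ`. -/
def homProd (A : ℕ → Set ℕ) : Set Baire := {x | ∀ n, x n ∈ A n}

/-- A family `(Aₙ)` of subsets of `ℕ` is uniformly `Σ¹₁`. -/
def UniformlySigma11 (A : ℕ → Set ℕ) : Prop :=
  ∃ R : ℕ × ℕ → List ℕ → Bool, Computable₂ R ∧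
    ∀ n m : ℕ, m ∈ A n ↔ ∃ y : Baire, ∀ k, R (n, m) (pre y k) = true

/-- A subset of Baire space is (lightface) `Σ¹₁`. -/
def Sigma11Set (S : Set Baire) : Prop :=
  ∃ R : List ℕ → List ℕ → Bool, Computable₂ R ∧
    ∀ x, x ∈ S ↔ ∃ y : Baire, ∀ m, R (pre x m) (pre y m) = true

/-- A set of finite sequences is (lightface) `Σ¹₁`. -/
def Sigma11List (T : Set (List ℕ)) : Prop :=
  ∃ R : List ℕ → List ℕ → Bool, Computable₂ R ∧
    ∀ σ, σ ∈ T ↔ ∃ y : Baire, ∀ m, R σ (pre y m) = true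

/-- A tree on `ℕ`: a set of finite sequences closed under prefixes. -/
def IsTree (T : Set (List ℕ)) : Prop := ∀ σ ∈ T, ∀ τ : List ℕ, τ <+: σ → τ ∈ T

/-- The set `[T]` of infinite paths through `T`. -/
def paths (T : Set (List ℕ)) : Set Baire := {x | ∀ n, pre x n ∈ T}

/-- A subset of `ℕ × ℕ` is (lightface) `Σ¹₁`. -/
def Sigma11Pairs (A : Set (ℕ × ℕ)) : Prop :=
  ∃ R : ℕ × ℕ → List ℕ → Bool, Computable₂ R ∧
    ∀ p : ℕ × ℕ, p ∈ A ↔ ∃ y : Baire, ∀ k, R p (pre y k) = true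

/-- A function `f : ℕ → ℕ` is `Δ¹₁`: its graph is both `Σ¹₁` and `Π¹₁`. -/
def Delta11Fun (f : ℕ → ℕ) : Prop :=
  Sigma11Pairs {p : ℕ × ℕ | f p.1 = p.2} ∧ Sigma11Pairs {p : ℕ × ℕ | f p.1 ≠ p.2}

theorem pre_length (x : Baire) (n : ℕ) : (pre x n).length = n := by simp [pre]

theorem pre_succ (x : Baire) (n : ℕ) : pre x (n + 1) = pre x n ++ [x n] := by
  simp [pre, List.range_succ]

theorem pre_succ_eq_cons (x : Baire) (n : ℕ) :
    pre x (n + 1) = x 0 :: pre (fun i => x (i + 1)) n := by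
  simp [pre, List.range_succ_eq_map, Function.comp_def]

theorem take_pre (x : Baire) {m n : ℕ} (h : m ≤ n) : (pre x n).take m = pre x m := by
  simp [pre, ← List.map_take, List.take_range, h]

theorem pre_prefix (x : Baire) {m n : ℕ} (h : m ≤ n) : pre x m <+: pre x n := by
  rw [← take_pre x h]
  exact List.take_prefix _ _

theorem getElem?_of_prefix {σ τ : List ℕ} (h : σ <+: τ) {n v : ℕ} (hv : σ[n]? = some v) :
    τ[n]? = some v := by
  obtain ⟨hn, rfl⟩ := List.getElem?_eq_some_iff.1 hv
  exact List.prefix_iff_getElem?.1 h n hn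

theorem getD_pre (x : Baire) {m n : ℕ} (h : m < n) : (pre x n).getD m 0 = x m := by
  simp [pre, h]

theorem finite_pre_image {A : ℕ → Set ℕ} (hA : ∀ n, (A n).Finite) (s : ℕ) :
    ((fun x => pre x s) '' homProd A).Finite := by
  induction s with
  | zero =>
    refine (Set.finite_singleton []).subset ?_
    rintro _ ⟨x, -, rfl⟩
    simp [pre]
  | succ s ih =>
    refine (ih.image2 (fun σ a => σ ++ [a]) (hA s)).subset ?_
    rintro _ ⟨x, hx, rfl⟩
    exact ⟨pre x s, ⟨x, hx, rfl⟩, x s, hx s, (pre_succ x s).symm⟩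

/-- The family whose `i`-th member is the set of values of `g i` on the initial segments of
length `s i` of members of `∏ₙ Aₙ`. -/
def imageFamily (s : ℕ → ℕ) (g : ℕ → List ℕ → ℕ) (A : ℕ → Set ℕ) (i : ℕ) : Set ℕ :=
  {m | ∃ x ∈ homProd A, g i (pre x (s i)) = m}

theorem imageFamily_finite (s : ℕ → ℕ) (g : ℕ → List ℕ → ℕ) {A : ℕ → Set ℕ}
    (hA : ∀ n, (A n).Finite) (i : ℕ) : (imageFamily s g A i).Finite := by
  refine ((finite_pre_image hA (s i)).image (g i)).subset ?_
  rintro _ ⟨x, hx, rfl⟩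
  exact ⟨_, ⟨x, hx, rfl⟩, rfl⟩

theorem UniformlySigma11.union {A B : ℕ → Set ℕ} (hA : UniformlySigma11 A)
    (hB : UniformlySigma11 B) : UniformlySigma11 (fun n => A n ∪ B n) := by
  obtain ⟨R, hR, hRA⟩ := hA
  obtain ⟨S, hS, hSB⟩ := hB
  refine ⟨fun p σ => bif σ.length == 0 then true else
    bif σ.getD 0 0 == 0 then R p σ.tail else S p σ.tail, ?_, ?_⟩
  · have htail : Computable fun q : (ℕ × ℕ) × List ℕ => q.2.tail :=
      (Primrec.list_tail.comp Primrec.snd).to_comp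
    refine Computable.cond
      (Primrec.beq.comp (Primrec.list_length.comp Primrec.snd) (Primrec.const 0)).to_comp
      (Computable.const true) (Computable.cond ?_ (hR.comp Computable.fst htail)
        (hS.comp Computable.fst htail))
    exact (Primrec.beq.comp ((Primrec.list_getD 0).comp Primrec.snd (Primrec.const 0))
      (Primrec.const 0)).to_comp
  · intro n m
    constructor
    · rintro (h | h)
      · obtain ⟨y, hy⟩ := (hRA n m).1 h
        refine ⟨fun i => Nat.casesOn i 0 y, fun k => ?_⟩
        cases k with
        | zero => simp [pre]
        | succ k => simpa [pre_succ_eq_cons] using hy k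
      · obtain ⟨y, hy⟩ := (hSB n m).1 h
        refine ⟨fun i => Nat.casesOn i 1 y, fun k => ?_⟩
        cases k with
        | zero => simp [pre]
        | succ k => simpa [pre_succ_eq_cons] using hy k
    · rintro ⟨y, hy⟩
      by_cases h0 : y 0 = 0
      · refine Or.inl ((hRA n m).2 ⟨fun i => y (i + 1), fun k => ?_⟩)
        simpa [pre_succ_eq_cons, h0] using hy (k + 1)
      · have h0' : (y 0 == 0) = false := by simpa using h0
        refine Or.inr ((hSB n m).2 ⟨fun i => y (i + 1), fun k => ?_⟩)
        simpa [pre_succ_eq_cons, h0'] using hy (k + 1)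

/-- The column of the finite sequence `σ`, seen as a partial array along `Nat.pair`. -/
def column (σ : List ℕ) (j l : ℕ) : List ℕ :=
  (List.range l).map fun i => σ.getD (Nat.pair j i) 0

theorem column_pre (z : Baire) {j l k : ℕ} (h : Nat.pair j l ≤ k) :
    column (pre z k) j l = pre (fun i => z (Nat.pair j i)) l := by
  refine List.map_congr_left fun i hi => getD_pre z (lt_of_lt_of_le ?_ h)
  exact Nat.pair_lt_pair_right _ (List.mem_range.1 hi)

theorem Primrec.column {α : Type*} [Primcodable α] {f : α → List ℕ} {g h : α → ℕ}
    (hf : Primrec f) (hg : Primrec g) (hh : Primrec h) :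
    Primrec fun a => column (f a) (g a) (h a) :=
  Primrec.list_map (Primrec.list_range.comp hh) <|
    (Primrec.list_getD 0).comp (hf.comp Primrec.fst)
      (Primrec₂.natPair.comp (hg.comp Primrec.fst) Primrec.snd)

theorem UniformlySigma11.imageFamily {A : ℕ → Set ℕ} (hA : UniformlySigma11 A) {s : ℕ → ℕ}
    {g : ℕ → List ℕ → ℕ} (hs : Primrec s) (hg : Primrec₂ g) :
    UniformlySigma11 (imageFamily s g A) := by
  obtain ⟨R, hR, hRA⟩ := hA
  refine ⟨fun p σ =>
    (!(decide (Nat.pair (σ.length.unpair.1.unpair.1 + 1) σ.length.unpair.1.unpair.2 < σ.length) &&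
        decide (Nat.pair 0 σ.length.unpair.1.unpair.1 < σ.length)) ||
      R (σ.length.unpair.1.unpair.1, σ.getD (Nat.pair 0 σ.length.unpair.1.unpair.1) 0)
        (column σ (σ.length.unpair.1.unpair.1 + 1) σ.length.unpair.1.unpair.2)) &&
    (!decide (Nat.pair 0 (s p.1) < σ.length) || (g p.1 (column σ 0 (s p.1)) == p.2)), ?_, ?_⟩
  · have hσ : Primrec fun q : (ℕ × ℕ) × List ℕ => q.2 := Primrec.snd
    have hlen : Primrec fun q : (ℕ × ℕ) × List ℕ => q.2.length := Primrec.list_length.comp hσ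
    have hk : Primrec fun q : (ℕ × ℕ) × List ℕ => q.2.length.unpair.1.unpair :=
      Primrec.unpair.comp (Primrec.fst.comp (Primrec.unpair.comp hlen))
    have hj := Primrec.fst.comp hk
    have hl := Primrec.snd.comp hk
    have hj1 := Primrec.succ.comp hj
    have h0j := Primrec₂.natPair.comp (Primrec.const 0) hj
    have hs1 := hs.comp (Primrec.fst.comp (Primrec.fst : Primrec fun q : (ℕ × ℕ) × List ℕ => q.1))
    refine Primrec.and.to_comp.comp (Primrec.or.to_comp.comp ?_ ?_) ?_
    · exact (Primrec.not.comp (Primrec.and.comp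
        (Primrec.nat_lt.comp (Primrec₂.natPair.comp hj1 hl) hlen).decide
        (Primrec.nat_lt.comp h0j hlen).decide)).to_comp
    · exact hR.comp (hj.pair ((Primrec.list_getD 0).comp hσ h0j)).to_comp
        (Primrec.column hσ hj1 hl).to_comp
    · exact (Primrec.or.comp (Primrec.not.comp
        (Primrec.nat_lt.comp (Primrec₂.natPair.comp (Primrec.const 0) hs1) hlen).decide)
        (Primrec.beq.comp (hg.comp (Primrec.fst.comp Primrec.fst)
          (Primrec.column hσ (Primrec.const 0) hs1)) (Primrec.snd.comp Primrec.fst))).to_comp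
  · intro n m
    constructor
    · rintro ⟨x, hx, hxm⟩
      choose w hw using fun j => (hRA j (x j)).1 (hx j)
      let z : Baire := fun i => Nat.casesOn i.unpair.1 (x i.unpair.2) fun j => w j i.unpair.2
      have hz0 : ∀ j, z (Nat.pair 0 j) = x j := fun j => by simp [z]
      have hz1 : ∀ j i, z (Nat.pair (j + 1) i) = w j i := fun j i => by simp [z]
      refine ⟨z, fun k => ?_⟩
      simp only [pre_length, Bool.and_eq_true, Bool.or_eq_true, Bool.not_eq_true',
        Bool.and_eq_false_iff, decide_eq_false_iff_not, beq_iff_eq]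
      constructor
      · generalize k.unpair.1.unpair = p
        by_cases h1 : Nat.pair (p.1 + 1) p.2 < k
        · by_cases h2 : Nat.pair 0 p.1 < k
          · right
            rw [column_pre z h1.le, getD_pre z h2, hz0]
            simpa [hz1] using hw p.1 p.2
          · exact Or.inl (Or.inr h2)
        · exact Or.inl (Or.inl h1)
      · by_cases h1 : Nat.pair 0 (s n) < k
        · right
          rw [column_pre z h1.le]
          simpa [hz0] using hxm
        · exact Or.inl h1
    · rintro ⟨z, hz⟩
      simp only [pre_length, Bool.and_eq_true, Bool.or_eq_true, Bool.not_eq_true',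
        Bool.and_eq_false_iff, decide_eq_false_iff_not, beq_iff_eq] at hz
      refine ⟨fun j => z (Nat.pair 0 j), fun j => (hRA _ _).2
        ⟨fun i => z (Nat.pair (j + 1) i), fun l => ?_⟩, ?_⟩
      · obtain ⟨N, hN⟩ : ∃ N, N = Nat.pair (j + 1) l + Nat.pair 0 j + 1 := ⟨_, rfl⟩
        have hk := Nat.right_le_pair (Nat.pair j l) N
        have h := (hz (Nat.pair (Nat.pair j l) N)).1
        simp only [Nat.unpair_pair] at h
        rw [column_pre z (by omega), getD_pre z (by omega)] at h
        rcases h with (h | h) | h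
        · omega
        · omega
        · exact h
      · have h := (hz (Nat.pair 0 (s n) + 1)).2
        rw [column_pre z (by omega)] at h
        rcases h with h | h
        · omega
        · exact h

/-- The output of the procedure which, reading `σ` letter by letter, appends `v` to an output of
length `n` whenever `q n` returns `v` on the part of `σ` read so far. -/
def runOutput (q : ℕ → List ℕ → Option ℕ) (σ : List ℕ) : ℕ → List ℕ
  | 0 => []
  | m + 1 => runOutput q σ m ++ (q (runOutput q σ m).length (σ.take (m + 1))).toList

theorem runOutput_congr (q : ℕ → List ℕ → Option ℕ) {σ τ : List ℕ} {m : ℕ}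
    (h : σ.take m = τ.take m) : runOutput q σ m = runOutput q τ m := by
  induction m with
  | zero => rfl
  | succ m ih =>
    have h' : σ.take m = τ.take m := by
      simpa [List.take_take] using congrArg (List.take m) h
    simp only [runOutput, ih h', h]

theorem runOutput_prefix (q : ℕ → List ℕ → Option ℕ) (σ : List ℕ) {m n : ℕ} (h : m ≤ n) :
    runOutput q σ m <+: runOutput q σ n := by
  induction n, h using Nat.le_induction with
  | base => exact List.prefix_refl _
  | succ n _ ih => exact ih.trans (List.prefix_append _ _)

theorem computable_runOutput {q : ℕ → List ℕ → Option ℕ} (hq : Computable₂ q) :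
    Computable fun σ => runOutput q σ σ.length := by
  have htoList : Primrec (Option.toList : Option ℕ → List ℕ) :=
    (Primrec.option_casesOn Primrec.id (Primrec.const [])
      (Primrec.list_cons.comp Primrec.snd (Primrec.const [])).to₂).of_eq
      fun o => by cases o <;> rfl
  have hout : Computable fun p : List ℕ × (ℕ × List ℕ) => p.2.2 :=
    Computable.snd.comp Computable.snd
  have htake : Computable fun p : List ℕ × (ℕ × List ℕ) => p.1.take (p.2.1 + 1) :=
    (Primrec.list_take.comp (Primrec.succ.comp (Primrec.fst.comp Primrec.snd))
      Primrec.fst).to_comp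
  refine (Computable.nat_rec (f := List.length) (g := fun _ : List ℕ => ([] : List ℕ))
    (h := fun σ p => p.2 ++ (q p.2.length (σ.take (p.1 + 1))).toList)
    Primrec.list_length.to_comp (Computable.const []) ?_).of_eq fun σ => ?_
  · exact Computable.list_append.comp hout <| htoList.to_comp.comp <|
      hq.comp (Primrec.list_length.to_comp.comp hout) htake
  · generalize σ.length = m
    induction m with
    | zero => rfl
    | succ m ih => simp only [runOutput, ← ih]

/-- A computable partial search which succeeds at arbitrarily late stages for every argument
gives rise to a Turing functional. -/
theorem exists_turingFunctional_of_search {q : ℕ → List ℕ → Option ℕ} (hq : Computable₂ q) :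
    ∃ Φ : TuringFunctional, ∀ x, (∀ n N, ∃ m ≥ N, (q n (pre x m)).isSome) →
      ∃ y, Φ.Eval x y ∧ ∀ n, ∃ m, q n (pre x m) = some (y n) := by
  refine ⟨⟨fun σ => runOutput q σ σ.length, computable_runOutput hq, ?_⟩, ?_⟩
  · rintro σ _ ⟨ρ, rfl⟩
    have h : runOutput q σ σ.length = runOutput q (σ ++ ρ) σ.length :=
      runOutput_congr q (by simp)
    rw [h]
    exact runOutput_prefix q _ (by simp)
  · intro x hx
    let S : ℕ → List ℕ := fun m => runOutput q (pre x m) m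
    have hS : ∀ m, S (m + 1) = S m ++ (q (S m).length (pre x (m + 1))).toList := by
      intro m
      have h : runOutput q (pre x (m + 1)) m = S m :=
        runOutput_congr q (by rw [take_pre x (Nat.le_succ m), take_pre x le_rfl])
      change runOutput q (pre x (m + 1)) (m + 1) = _
      rw [runOutput, h, take_pre x le_rfl]
    have hmono : ∀ m n, m ≤ n → (S m).length ≤ (S n).length := by
      intro m n h
      induction n, h using Nat.le_induction with
      | base => exact le_rfl
      | succ n _ ih => exact ih.trans (by simp [hS n])
    have hlen : ∀ n, ∃ m, n ≤ (S m).length := by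
      intro n
      induction n with
      | zero => exact ⟨0, Nat.zero_le _⟩
      | succ n ih =>
        obtain ⟨m, hm⟩ := ih
        obtain ⟨k, hk, hsome⟩ := hx n (m + 1)
        obtain ⟨k, rfl⟩ : ∃ k', k = k' + 1 := ⟨k - 1, by omega⟩
        have hmk := hmono m k (by omega)
        rcases Nat.lt_or_ge n (S k).length with h | h
        · exact ⟨k, h⟩
        · refine ⟨k + 1, ?_⟩
          have hn : (S k).length = n := by omega
          obtain ⟨v, hv⟩ := Option.isSome_iff_exists.1 hsome
          simp [hS k, hn, hv]
    have hval : ∀ m n v, (S m)[n]? = some v → ∃ k, q n (pre x k) = some v := by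
      intro m n v h
      induction m with
      | zero => simp [S, runOutput] at h
      | succ m ih =>
        rw [hS m, List.getElem?_append] at h
        split_ifs at h with hn
        · exact ih h
        · rcases hq' : q (S m).length (pre x (m + 1)) with _ | w
          · simp [hq'] at h
          · simp only [hq', Option.toList_some, List.getElem?_singleton] at h
            split_ifs at h with h0
            obtain rfl : n = (S m).length := by omega
            exact ⟨m + 1, by rw [hq', h]⟩
    have hy : ∀ n : ℕ, ∃ v m, (S m)[n]? = some v := by
      intro n
      obtain ⟨m, hm⟩ := hlen (n + 1)
      exact ⟨(S m)[n], m, List.getElem?_eq_getElem (by omega)⟩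
    choose y k hk using hy
    refine ⟨y, fun n => ⟨k n, ?_⟩, fun n => hval _ _ _ (hk n)⟩
    simpa only [pre_length] using hk n

theorem medvedevLE_of_imageFamily_subset {A X : ℕ → Set ℕ} {s : ℕ → ℕ} {g : ℕ → List ℕ → ℕ}
    (hs : Primrec s) (hg : Primrec₂ g) (hX : ∀ i, imageFamily s g A i ⊆ X i) :
    MedvedevLE (homProd X) (homProd A) := by
  obtain ⟨Φ, hΦ⟩ := exists_turingFunctional_of_search
    (q := fun i σ => bif decide (s i ≤ σ.length) then some (g i (σ.take (s i))) else none) (by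
      have hsi : Primrec fun p : ℕ × List ℕ => s p.1 := hs.comp Primrec.fst
      exact (Primrec.cond
        (Primrec.nat_le.comp hsi (Primrec.list_length.comp Primrec.snd)).decide
        (Primrec.option_some.comp (hg.comp Primrec.fst (Primrec.list_take.comp hsi Primrec.snd)))
        (Primrec.const none)).to_comp)
  refine ⟨Φ, fun x hx => ?_⟩
  obtain ⟨y, hy, hq⟩ := hΦ x fun n N =>
    ⟨max N (s n), le_max_left _ _, by simp [pre_length]⟩
  refine ⟨y, fun n => hX n ⟨x, hx, ?_⟩, hy⟩
  obtain ⟨m, hm⟩ := hq n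
  by_cases h : s n ≤ m
  · simpa [pre_length, h, take_pre] using hm
  · simp [pre_length, h] at hm

theorem isCompact_homProd {A : ℕ → Set ℕ} (hA : ∀ n, (A n).Finite) : IsCompact (homProd A) := by
  have h : homProd A = Set.univ.pi A := by ext; simp [homProd]
  rw [h]
  exact isCompact_univ_pi fun n => (hA n).isCompact

theorem isOpen_setOf_pre (p : List ℕ → Prop) (m : ℕ) : IsOpen {x : Baire | p (pre x m)} := by
  have hcont : Continuous fun (x : Baire) (i : Fin m) => x i := by fun_prop
  have h : {x : Baire | p (pre x m)} =
      (fun (x : Baire) (i : Fin m) => x i) ⁻¹' {v | p (List.ofFn v)} := by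
    ext x
    simp [pre, List.ofFn_eq_map, ← List.map_coe_finRange_eq_range, Function.comp_def]
  rw [h]
  exact (isOpen_discrete _).preimage hcont

theorem exists_uniform_use {A : ℕ → Set ℕ} (hA : ∀ n, (A n).Finite) {Φ : TuringFunctional}
    (n : ℕ) (hΦ : ∀ x ∈ homProd A, ∃ m, ((Φ.φ (pre x m))[n]?).isSome) :
    ∃ s, ∀ t ≥ s, ∀ x ∈ homProd A, ((Φ.φ (pre x t))[n]?).isSome := by
  have hmono : ∀ x s t, s ≤ t → ((Φ.φ (pre x s))[n]?).isSome →
      ((Φ.φ (pre x t))[n]?).isSome := by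
    intro x s t hst h
    have := (Φ.mono _ _ (pre_prefix x hst)).length_le
    simp only [isSome_getElem?] at h ⊢
    exact h.trans_le this
  obtain ⟨s, hs⟩ := (isCompact_homProd hA).elim_directed_cover
    (fun m => {x : Baire | ((Φ.φ (pre x m))[n]?).isSome})
    (fun m => isOpen_setOf_pre (fun σ => ((Φ.φ σ)[n]?).isSome) m)
    (fun x hx => Set.mem_iUnion.2 (hΦ x hx))
    (directed_of_isDirected_le fun s t hst x hx => hmono x s t hst hx)
  exact ⟨s, fun t ht x hx => hmono x s t ht (hs hx)⟩

/-- The value of the program with index `c` on `(n, σ)` if it halts within `t` steps, and `0`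
otherwise. -/
def stageEval (c n t : ℕ) (σ : List ℕ) : ℕ :=
  (Nat.Partrec.Code.evaln t (Denumerable.ofNat Nat.Partrec.Code c) (Encodable.encode (n, σ))).getD 0

theorem Primrec.stageEval {α : Type*} [Primcodable α] {c n t : α → ℕ} {σ : α → List ℕ}
    (hc : Primrec c) (hn : Primrec n) (ht : Primrec t) (hσ : Primrec σ) :
    Primrec fun a => stageEval (c a) (n a) (t a) (σ a) :=
  Primrec.option_getD.comp (Nat.Partrec.Code.primrec_evaln.comp
    ((ht.pair ((Primrec.ofNat _).comp hc)).pair (Primrec.encode.comp (hn.pair hσ))))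
    (Primrec.const 0)

theorem exists_stageEval {h : ℕ × List ℕ → ℕ} (hh : Computable h) :
    ∃ c, (∀ n t σ, stageEval c n t σ ≠ 0 → stageEval c n t σ = h (n, σ)) ∧
      ∀ n σ, ∃ t₀, ∀ t ≥ t₀, stageEval c n t σ = h (n, σ) := by
  obtain ⟨c, hc⟩ := Nat.Partrec.Code.exists_code.1 hh
  have heval : ∀ p v, v ∈ c.eval (Encodable.encode p) ↔ v = h p := by
    intro p v
    rw [hc]
    simp only [Encodable.encodek, Part.coe_some, Part.bind_some, PFun.coe_val, Part.map_some,
      Encodable.encode_nat, Part.mem_some_iff]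
  refine ⟨Encodable.encode c, fun n t σ hne => ?_, fun n σ => ?_⟩
  · unfold stageEval at hne ⊢
    rw [Denumerable.ofNat_encode] at hne ⊢
    rcases hv : Nat.Partrec.Code.evaln t c (Encodable.encode (n, σ)) with _ | v
    · exact absurd (by rw [hv]; rfl) hne
    · exact (heval _ _).1 (Nat.Partrec.Code.evaln_sound hv)
  · obtain ⟨t₀, ht₀⟩ := Nat.Partrec.Code.evaln_complete.1 ((heval (n, σ) _).2 rfl)
    refine ⟨t₀, fun t ht => ?_⟩
    have := Nat.Partrec.Code.evaln_mono ht ht₀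
    unfold stageEval
    rw [Denumerable.ofNat_encode, Option.mem_def.1 this]
    rfl

theorem MedvedevLE.exists_index {A Y : ℕ → Set ℕ} (hA : ∀ n, (A n).Finite)
    (hYA : MedvedevLE (homProd Y) (homProd A)) :
    ∃ c, (∀ n s t, ∀ x ∈ homProd A, stageEval c n t (pre x s) ≠ 0 →
        stageEval c n t (pre x s) - 1 ∈ Y n) ∧
      ∀ n, ∃ s₀, ∀ s ≥ s₀, ∃ t₀, ∀ t ≥ t₀, ∀ x ∈ homProd A, stageEval c n t (pre x s) ≠ 0 := by
  obtain ⟨Φ, hΦ⟩ := hYA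
  let h : ℕ × List ℕ → ℕ := fun p => (((Φ.φ p.2)[p.1]?).map Nat.succ).getD 0
  have hh : Computable h :=
    (Primrec.option_getD.comp (Primrec.option_map Primrec.id (Primrec.succ.comp Primrec.snd).to₂)
      (Primrec.const 0)).to_comp.comp
      (Computable.list_getElem?.comp (Φ.computable.comp Computable.snd) Computable.fst)
  obtain ⟨c, hsound, hcomplete⟩ := exists_stageEval hh
  refine ⟨c, fun n s t x hx hne => ?_, fun n => ?_⟩
  · have heq := hsound n t _ hne
    rw [heq] at hne ⊢
    obtain ⟨y, hy, hxy⟩ := hΦ x hx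
    obtain ⟨m, hm⟩ := hxy n
    rcases hv : (Φ.φ (pre x s))[n]? with _ | v
    · simp [h, hv] at hne
    · have hvy : v = y n := by
        have h₁ := getElem?_of_prefix (Φ.mono _ _ (pre_prefix x (le_max_left s m))) hv
        have h₂ := getElem?_of_prefix (Φ.mono _ _ (pre_prefix x (le_max_right s m))) hm
        exact Option.some.inj (h₁.symm.trans h₂)
      simpa [h, hv, hvy] using hy n
  · obtain ⟨s₀, hs₀⟩ := exists_uniform_use hA (Φ := Φ) n fun x hx => by
      obtain ⟨y, -, hxy⟩ := hΦ x hx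
      obtain ⟨m, hm⟩ := hxy n
      exact ⟨m, by simp [hm]⟩
    refine ⟨s₀, fun s hs => ?_⟩
    choose T hT using hcomplete n
    obtain ⟨t₀, ht₀⟩ := ((finite_pre_image hA s).image T).bddAbove
    refine ⟨t₀, fun t ht x hx => ?_⟩
    rw [hT _ t ((ht₀ ⟨_, ⟨x, hx, rfl⟩, rfl⟩).trans ht)]
    obtain ⟨v, hv⟩ := Option.isSome_iff_exists.1 (hs₀ s hs x hx)
    simp [h, hv]

theorem medvedevLE_of_stage_values {X Y : ℕ → Set ℕ} (e : ℕ)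
    (hsound : ∀ n p, ∀ v ∈ X (Nat.pair e (Nat.pair n p)), v ≠ 0 → v - 1 ∈ Y n)
    (hcomplete : ∀ n N, ∃ p ≥ N, 0 ∉ X (Nat.pair e (Nat.pair n p))) :
    MedvedevLE (homProd Y) (homProd X) := by
  let q : ℕ → List ℕ → Option ℕ := fun n σ =>
    bif ((σ.length - 1).unpair.1 == e && (σ.length - 1).unpair.2.unpair.1 == n) &&
      !(σ.getD (σ.length - 1) 0 == 0)
    then some (σ.getD (σ.length - 1) 0 - 1) else none
  have hq : Computable₂ q := by
    have hσ : Primrec fun a : ℕ × List ℕ => a.2 := Primrec.snd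
    have hj : Primrec fun a : ℕ × List ℕ => a.2.length - 1 :=
      Primrec.pred.comp (Primrec.list_length.comp hσ)
    have hu := Primrec.unpair.comp hj
    have hv := (Primrec.list_getD 0).comp hσ hj
    exact (Primrec.cond
      (Primrec.and.comp
        (Primrec.and.comp (Primrec.beq.comp (Primrec.fst.comp hu) (Primrec.const e))
          (Primrec.beq.comp (Primrec.fst.comp (Primrec.unpair.comp (Primrec.snd.comp hu)))
            Primrec.fst))
        (Primrec.not.comp (Primrec.beq.comp hv (Primrec.const 0))))
      (Primrec.option_some.comp (Primrec.pred.comp hv)) (Primrec.const none)).to_comp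
  have hq_succ : ∀ (z : Baire) n j, q n (pre z (j + 1)) =
      bif (j.unpair.1 == e && j.unpair.2.unpair.1 == n) && !(z j == 0)
      then some (z j - 1) else none := by
    intro z n j
    simp only [q, pre_length, Nat.add_sub_cancel, getD_pre z (Nat.lt_succ_self j)]
  obtain ⟨Φ, hΦ⟩ := exists_turingFunctional_of_search hq
  refine ⟨Φ, fun z hz => ?_⟩
  obtain ⟨y, hy, hqy⟩ := hΦ z fun n N => by
    obtain ⟨p, hp, h0⟩ := hcomplete n N
    refine ⟨Nat.pair e (Nat.pair n p) + 1, ?_, ?_⟩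
    · have h₁ := Nat.right_le_pair e (Nat.pair n p)
      have h₂ := Nat.right_le_pair n p
      omega
    · have hne : z (Nat.pair e (Nat.pair n p)) ≠ 0 := fun h => h0 (h ▸ hz _)
      have hne' : (z (Nat.pair e (Nat.pair n p)) == 0) = false := by simpa using hne
      simp [hq_succ, hne']
  refine ⟨y, fun n => ?_, hy⟩
  obtain ⟨m, hm⟩ := hqy n
  cases m with
  | zero => simp [q, pre] at hm
  | succ j =>
    rw [hq_succ] at hm
    rcases hb : (j.unpair.1 == e && j.unpair.2.unpair.1 == n) && !(z j == 0) with _ | _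
    · simp [hb] at hm
    · simp only [hb, cond_true, Option.some.injEq] at hm
      simp only [Bool.and_eq_true, beq_iff_eq, Bool.not_eq_true', beq_eq_false_iff_ne] at hb
      obtain ⟨⟨rfl, rfl⟩, hne⟩ := hb
      rw [← hm]
      refine hsound _ j.unpair.2.unpair.2 _ ?_ hne
      simpa only [Nat.pair_unpair] using hz j

/-- Homogeneous `Σ¹₁` sets with finite factors have infima among homogeneous
`Σ¹₁` sets, realized by an all-or-(nonempty-finite) product. -/
theorem exists_infimum_homogeneous_finite :
    ∀ A B : ℕ → Set ℕ, UniformlySigma11 A → UniformlySigma11 B →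
      (∀ n, (A n).Finite) → (∀ n, (B n).Finite) →
      (homProd A).Nonempty → (homProd B).Nonempty →
      ∃ X : ℕ → Set ℕ, UniformlySigma11 X ∧
        (∀ n, X n = Set.univ ∨ ((X n).Nonempty ∧ (X n).Finite)) ∧
        MedvedevLE (homProd X) (homProd A) ∧ MedvedevLE (homProd X) (homProd B) ∧
        ∀ Y : ℕ → Set ℕ, UniformlySigma11 Y → (homProd Y).Nonempty →
          MedvedevLE (homProd Y) (homProd A) → MedvedevLE (homProd Y) (homProd B) →
          MedvedevLE (homProd Y) (homProd X) := by
  intro A B hA hB hAf hBf hAne hBne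
  let s : ℕ → ℕ := fun i => i.unpair.2.unpair.2.unpair.1
  let gA : ℕ → List ℕ → ℕ := fun i σ =>
    stageEval i.unpair.1.unpair.1 i.unpair.2.unpair.1 i.unpair.2.unpair.2.unpair.2 σ
  let gB : ℕ → List ℕ → ℕ := fun i σ =>
    stageEval i.unpair.1.unpair.2 i.unpair.2.unpair.1 i.unpair.2.unpair.2.unpair.2 σ
  have hu₁ : Primrec fun i : ℕ => i.unpair.1.unpair :=
    Primrec.unpair.comp (Primrec.fst.comp Primrec.unpair)
  have hu₂ : Primrec fun i : ℕ => i.unpair.2.unpair :=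
    Primrec.unpair.comp (Primrec.snd.comp Primrec.unpair)
  have hu₃ : Primrec fun i : ℕ => i.unpair.2.unpair.2.unpair :=
    Primrec.unpair.comp (Primrec.snd.comp hu₂)
  have hs : Primrec s := Primrec.fst.comp hu₃
  have hn : Primrec fun a : ℕ × List ℕ => a.1.unpair.2.unpair.1 :=
    (Primrec.fst.comp hu₂).comp Primrec.fst
  have ht : Primrec fun a : ℕ × List ℕ => a.1.unpair.2.unpair.2.unpair.2 :=
    (Primrec.snd.comp hu₃).comp Primrec.fst
  have hgA : Primrec₂ gA :=
    Primrec.stageEval ((Primrec.fst.comp hu₁).comp Primrec.fst) hn ht Primrec.snd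
  have hgB : Primrec₂ gB :=
    Primrec.stageEval ((Primrec.snd.comp hu₁).comp Primrec.fst) hn ht Primrec.snd
  refine ⟨fun i => imageFamily s gA A i ∪ imageFamily s gB B i,
    (hA.imageFamily hs hgA).union (hB.imageFamily hs hgB), fun i => Or.inr ⟨?_, ?_⟩,
    medvedevLE_of_imageFamily_subset hs hgA fun i => Set.subset_union_left,
    medvedevLE_of_imageFamily_subset hs hgB fun i => Set.subset_union_right, ?_⟩
  · obtain ⟨x, hx⟩ := hAne
    exact ⟨_, Or.inl ⟨x, hx, rfl⟩⟩
  · exact (imageFamily_finite s gA hAf i).union (imageFamily_finite s gB hBf i)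
  · intro Y _ _ hYA hYB
    obtain ⟨c, hc, hc'⟩ := hYA.exists_index hAf
    obtain ⟨d, hd, hd'⟩ := hYB.exists_index hBf
    refine medvedevLE_of_stage_values (Nat.pair c d) ?_ ?_
    · rintro n p v (⟨x, hx, rfl⟩ | ⟨x, hx, rfl⟩) hv
      · simp only [gA, Nat.unpair_pair] at hv ⊢
        exact hc _ _ _ x hx hv
      · simp only [gB, Nat.unpair_pair] at hv ⊢
        exact hd _ _ _ x hx hv
    · intro n N
      obtain ⟨s₁, h₁⟩ := hc' n
      obtain ⟨s₂, h₂⟩ := hd' n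
      obtain ⟨t₁, h₁⟩ := h₁ (max s₁ s₂) (le_max_left _ _)
      obtain ⟨t₂, h₂⟩ := h₂ (max s₁ s₂) (le_max_right _ _)
      let t := max N (max t₁ t₂)
      refine ⟨Nat.pair (max s₁ s₂) t, (le_max_left _ _).trans (Nat.right_le_pair _ t), ?_⟩
      rintro (⟨x, hx, h0⟩ | ⟨x, hx, h0⟩)
      · simp only [gA, s, Nat.unpair_pair] at h0
        exact h₁ t ((le_max_left _ _).trans (le_max_right _ _)) x hx h0
      · simp only [gB, s, Nat.unpair_pair] at h0
        exact h₂ t ((le_max_right _ _).trans (le_max_right _ _)) x hx h0
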